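/- The rate function I has compact sublevel sets: for every k ∈ (0,∞), the set S_k = {m ∈ 𝒫(Δ°) : I(m) ≤ k} is a compact subset of 𝒫(Δ°). In particular, I is lower semicontinuous on 𝒫(Δ°). -/

import Mathlib

open Real MeasureTheory

/-- Relative entropy of probability vectors on a finite set. -/
noncomputable def relEnt {d : ℕ} (ν μ : Fin d → ℝ) : ℝ := ∑ x, ν x * Real.log (ν x / μ x)

/-- The kernel `K(m) = mA` (row vector–matrix product). -/
noncomputable def Kker {d : ℕ} (A : Fin d → Fin d → ℝ) (m : Fin d → ℝ) : Fin d → ℝ :=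
  fun x => ∑ y, m y * A y x

/-- `M` is the continuous solution of `M(t) = m - ∫_0^t η(s) ds + ∫_0^t M(s) ds` on `[0,∞)`. -/
def IsSol {d : ℕ} (m : Fin d → ℝ) (η M : ℝ → Fin d → ℝ) : Prop :=
  ContinuousOn M (Set.Ici 0) ∧
  ∀ t, 0 ≤ t → ∀ x, M t x = m x - (∫ s in (0:ℝ)..t, η s x) + ∫ s in (0:ℝ)..t, M s x

/-- `η ∈ 𝒰(m)` with associated solution `M`: the control is measurable, simplex-valued, and the
solution trajectory stays in the simplex. -/
def IsAdmissible {d : ℕ} (m : Fin d → ℝ) (η M : ℝ → Fin d → ℝ) : Prop :=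
  (∀ x, Measurable fun s => η s x) ∧ (∀ s, 0 ≤ s → η s ∈ stdSimplex ℝ (Fin d)) ∧
  IsSol m η M ∧ ∀ t, 0 ≤ t → M t ∈ stdSimplex ℝ (Fin d)

/-- Infinite horizon discounted relative entropy cost of a control/trajectory pair. -/
noncomputable def cost {d : ℕ} (A : Fin d → Fin d → ℝ) (η M : ℝ → Fin d → ℝ) : ℝ :=
  ∫ s in Set.Ioi (0:ℝ), Real.exp (-s) * relEnt (η s) (Kker A (M s))

/-- The rate function `I(m) = inf_{η ∈ 𝒰(m)} ∫_0^∞ e^{-s} R(η(s) ‖ K(M(s))) ds`. -/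
noncomputable def rateI {d : ℕ} (A : Fin d → Fin d → ℝ) (m : Fin d → ℝ) : ℝ :=
  sInf { c | ∃ η M : ℝ → Fin d → ℝ, IsAdmissible m η M ∧ c = cost A η M }

open Set

lemma aux_Kker_mem {d : ℕ} {B : Fin d → Fin d → ℝ} (hB : ∀ x y, 0 ≤ B x y)
    (hr : ∀ x, ∑ y, B x y = 1) {m : Fin d → ℝ} (hm : m ∈ stdSimplex ℝ (Fin d)) :
    Kker B m ∈ stdSimplex ℝ (Fin d) := by
  refine ⟨fun x => Finset.sum_nonneg fun y _ => mul_nonneg (hm.1 y) (hB y x), ?_⟩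
  unfold Kker
  rw [Finset.sum_comm]
  simp_rw [← Finset.mul_sum, hr, mul_one]
  exact hm.2

lemma aux_intM {d : ℕ} {m : Fin d → ℝ} {η M : ℝ → Fin d → ℝ} (h : IsAdmissible m η M)
    {t : ℝ} (ht : 0 ≤ t) (x : Fin d) : IntervalIntegrable (fun s => M s x) volume 0 t := by
  apply ContinuousOn.intervalIntegrable
  rw [uIcc_of_le ht]
  have := h.2.2.1.1.mono (Icc_subset_Ici_self : Icc 0 t ⊆ Ici 0)
  exact (continuous_apply x).comp_continuousOn this

lemma aux_le_one {d : ℕ} {m : Fin d → ℝ} (hm : m ∈ stdSimplex ℝ (Fin d)) (x : Fin d) :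
    m x ≤ 1 := by
  rw [← hm.2]
  exact Finset.single_le_sum (fun i _ => hm.1 i) (Finset.mem_univ x)

lemma aux_intη {d : ℕ} {m : Fin d → ℝ} {η M : ℝ → Fin d → ℝ} (h : IsAdmissible m η M)
    {t : ℝ} (ht : 0 ≤ t) (x : Fin d) : IntervalIntegrable (fun s => η s x) volume 0 t := by
  rw [intervalIntegrable_iff, uIoc_of_le ht]
  apply Measure.integrableOn_of_bounded (M := 1) (by simp) (h.1 x).aestronglyMeasurable
  filter_upwards [ae_restrict_mem measurableSet_Ioc] with s hs
  have := h.2.1 s hs.1.le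
  rw [Real.norm_eq_abs, abs_of_nonneg (this.1 x)]
  exact aux_le_one this x

lemma aux_push {d : ℕ} {m : Fin d → ℝ} {η M : ℝ → Fin d → ℝ} (h : IsAdmissible m η M)
    {B : Fin d → Fin d → ℝ} (hB : ∀ x y, 0 ≤ B x y) (hr : ∀ x, ∑ y, B x y = 1) :
    IsAdmissible (Kker B m) (fun s => Kker B (η s)) (fun s => Kker B (M s)) := by
  refine ⟨fun x => ?_, fun s hs => aux_Kker_mem hB hr (h.2.1 s hs), ⟨?_, ?_⟩,
    fun s hs => aux_Kker_mem hB hr (h.2.2.2 s hs)⟩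
  · unfold Kker
    exact Finset.measurable_sum _ fun y _ => (h.1 y).mul_const _
  · have : Continuous (Kker B) := by unfold Kker; fun_prop
    exact this.comp_continuousOn h.2.2.1.1
  · intro t ht x
    simp only [Kker]
    rw [intervalIntegral.integral_finsetSum (fun y _ => (aux_intη h ht y).mul_const _),
      intervalIntegral.integral_finsetSum (fun y _ => (aux_intM h ht y).mul_const _),
      ← Finset.sum_sub_distrib, ← Finset.sum_add_distrib]
    refine Finset.sum_congr rfl fun y _ => ?_
    rw [intervalIntegral.integral_mul_const, intervalIntegral.integral_mul_const,
      h.2.2.1.2 t ht y]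
    ring

lemma aux_growth {d : ℕ} {m : Fin d → ℝ} {η M : ℝ → Fin d → ℝ} (h : IsAdmissible m η M)
    {t : ℝ} (ht : 0 ≤ t) (x : Fin d) :
    (∫ s in (0:ℝ)..t, η s x) ≤ m x * exp t ∧ (∫ s in (0:ℝ)..t, M s x) ≤ m x * exp t := by
  have hm0 : 0 ≤ m x := by
    have h1 := h.2.2.1.2 0 le_rfl x
    simp at h1
    rw [← h1]; exact (h.2.2.2 0 le_rfl).1 x
  have hη0 : ∀ t, 0 ≤ t → 0 ≤ ∫ s in (0:ℝ)..t, η s x := fun t ht =>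
    intervalIntegral.integral_nonneg ht fun s hs => (h.2.1 s hs.1).1 x
  set N : ℝ → ℝ := fun s => M (max s 0) x with hN
  have hNc : Continuous N := by
    have := h.2.2.1.1.comp_continuous (f := fun s : ℝ => max s 0) (by fun_prop)
      (fun s => mem_Ici.2 (le_max_right _ _))
    exact (continuous_apply x).comp this
  have hNM : ∀ t, 0 ≤ t → ∫ s in (0:ℝ)..t, N s = ∫ s in (0:ℝ)..t, M s x := by
    intro t ht
    apply intervalIntegral.integral_congr
    intro s hs
    rw [uIcc_of_le ht] at hs
    simp [hN, max_eq_left hs.1]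
  set Φ : ℝ → ℝ := fun t => ∫ s in (0:ℝ)..t, N s with hΦ
  have hd : ∀ t, HasDerivAt (fun t => exp (-t) * (m x + Φ t))
      (exp (-t) * (-1) * (m x + Φ t) + exp (-t) * (N t)) t := by
    intro t
    have h1 : HasDerivAt Φ (N t) t :=
      intervalIntegral.integral_hasDerivAt_right (hNc.intervalIntegrable _ _)
        (hNc.stronglyMeasurableAtFilter _ _) hNc.continuousAt
    exact ((hasDerivAt_neg t).exp).mul (h1.const_add _)
  have hanti : AntitoneOn (fun t => exp (-t) * (m x + Φ t)) (Ici 0) := by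
    apply antitoneOn_of_deriv_nonpos (convex_Ici 0)
    · exact fun t _ => (hd t).continuousAt.continuousWithinAt
    · exact fun t _ => (hd t).differentiableAt.differentiableWithinAt
    · intro t ht
      rw [interior_Ici] at ht
      have ht : 0 ≤ t := le_of_lt ht
      rw [(hd t).deriv]
      have h1 := h.2.2.1.2 t ht x
      have h2 := hη0 t ht
      have h3 : N t = M t x := by simp [hN, max_eq_left ht]
      have h4 := hNM t ht
      have h5 : N t ≤ m x + Φ t := by simp only [hΦ]; linarith
      nlinarith [exp_pos (-t)]
  have h1 := hanti (self_mem_Ici) (mem_Ici.2 ht) ht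
  simp [hΦ] at h1
  rw [hNM t ht] at h1
  have h2 : m x + ∫ s in (0:ℝ)..t, M s x ≤ m x * exp t := by
    have := mul_le_mul_of_nonneg_left h1 (exp_pos t).le
    rw [← mul_assoc, ← exp_add] at this
    simp at this
    linarith
  have h3 := h.2.2.1.2 t ht x
  have h4 := (h.2.2.2 t ht).1 x
  constructor <;> linarith

lemma aux_K_lower {d : ℕ} {A : Fin d → Fin d → ℝ} {δ₀ : ℝ} (hA : ∀ x y, δ₀ ≤ A x y)
    {m : Fin d → ℝ} (hm : m ∈ stdSimplex ℝ (Fin d)) (x : Fin d) : δ₀ ≤ Kker A m x := by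
  calc δ₀ = ∑ y, m y * δ₀ := by rw [← Finset.sum_mul, hm.2, one_mul]
    _ ≤ _ := Finset.sum_le_sum fun y _ => mul_le_mul_of_nonneg_left (hA y x) (hm.1 y)

lemma aux_cont {d : ℕ} {A : Fin d → Fin d → ℝ} {δ₀ : ℝ} (hδ₀ : 0 < δ₀)
    (hA : ∀ x y, δ₀ ≤ A x y) :
    ContinuousOn (fun p : (Fin d → ℝ) × (Fin d → ℝ) => relEnt p.1 (Kker A p.2))
      (stdSimplex ℝ (Fin d) ×ˢ stdSimplex ℝ (Fin d)) := by
  have hK : Continuous (Kker A) := by unfold Kker; fun_prop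
  have : ContinuousOn (fun p : (Fin d → ℝ) × (Fin d → ℝ) =>
      ∑ x, (p.1 x * log (p.1 x) - p.1 x * log (Kker A p.2 x)))
      (stdSimplex ℝ (Fin d) ×ˢ stdSimplex ℝ (Fin d)) := by
    refine continuousOn_finsetSum _ fun x _ => ContinuousOn.sub ?_ ?_
    · exact (Real.continuous_mul_log.comp (by fun_prop : Continuous
        fun p : (Fin d → ℝ) × (Fin d → ℝ) => p.1 x)).continuousOn
    · refine ContinuousOn.mul (by fun_prop) (ContinuousOn.log ?_ ?_)
      · exact ((continuous_apply x).comp (hK.comp continuous_snd)).continuousOn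
      · intro p hp
        exact (hδ₀.trans_le (aux_K_lower hA hp.2 x)).ne'
  refine this.congr fun p hp => ?_
  refine Finset.sum_congr rfl fun x _ => ?_
  have h1 := (hδ₀.trans_le (aux_K_lower hA hp.2 x)).ne'
  by_cases h0 : p.1 x = 0
  · simp [h0]
  · rw [Real.log_div h0 h1]; ring

lemma aux_modulus {d : ℕ} {A : Fin d → Fin d → ℝ} {δ₀ : ℝ} (hδ₀ : 0 < δ₀)
    (hA : ∀ x y, δ₀ ≤ A x y) :
    ∃ L : ℝ, 0 ≤ L ∧
      (∀ ν ∈ stdSimplex ℝ (Fin d), ∀ μ ∈ stdSimplex ℝ (Fin d), |relEnt ν (Kker A μ)| ≤ L) ∧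
      ∀ ε > 0, ∃ C : ℝ, 0 ≤ C ∧ ∀ ν ∈ stdSimplex ℝ (Fin d), ∀ μ ∈ stdSimplex ℝ (Fin d),
        ∀ ν' ∈ stdSimplex ℝ (Fin d), ∀ μ' ∈ stdSimplex ℝ (Fin d),
        relEnt ν (Kker A μ) - relEnt ν' (Kker A μ') ≤ ε + C * (dist ν ν' + dist μ μ') := by
  have hc := aux_cont hδ₀ hA
  have hS : IsCompact (stdSimplex ℝ (Fin d) ×ˢ stdSimplex ℝ (Fin d)) :=
    (isCompact_stdSimplex ℝ _).prod (isCompact_stdSimplex ℝ _)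
  obtain ⟨L, hL⟩ := hS.exists_bound_of_continuousOn hc
  have hL' : ∀ ν ∈ stdSimplex ℝ (Fin d), ∀ μ ∈ stdSimplex ℝ (Fin d),
      |relEnt ν (Kker A μ)| ≤ |L| := fun ν hν μ hμ => (hL (ν, μ) ⟨hν, hμ⟩).trans (le_abs_self L)
  refine ⟨|L|, abs_nonneg _, hL', fun ε hε => ?_⟩
  have hu := hS.uniformContinuousOn_of_continuous hc
  obtain ⟨δ, hδ, hu⟩ := Metric.uniformContinuousOn_iff.1 hu ε hε
  refine ⟨2 * |L| / δ, by positivity, fun ν hν μ hμ ν' hν' μ' hμ' => ?_⟩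
  have hn : 0 ≤ dist ν ν' + dist μ μ' := by positivity
  by_cases hd : dist ν ν' + dist μ μ' < δ
  · have := hu (ν, μ) ⟨hν, hμ⟩ (ν', μ') ⟨hν', hμ'⟩ (by
      rw [Prod.dist_eq]
      exact (max_le_add_of_nonneg dist_nonneg dist_nonneg).trans_lt hd)
    rw [Real.dist_eq] at this
    have h2 := (abs_lt.1 this).2
    have : 0 ≤ 2 * |L| / δ * (dist ν ν' + dist μ μ') := by positivity
    simp only at h2
    linarith
  · push Not at hd
    have h1 := (abs_le.1 (hL' ν hν μ hμ)).2
    have h2 := (abs_le.1 (hL' ν' hν' μ' hμ')).1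
    have : 2 * |L| ≤ 2 * |L| / δ * (dist ν ν' + dist μ μ') := by
      rw [div_mul_eq_mul_div, le_div_iff₀ hδ]
      exact mul_le_mul_of_nonneg_left hd (by positivity)
    linarith

lemma aux_integrable {d : ℕ} {A : Fin d → Fin d → ℝ} {L : ℝ}
    (hL : ∀ ν ∈ stdSimplex ℝ (Fin d), ∀ μ ∈ stdSimplex ℝ (Fin d), |relEnt ν (Kker A μ)| ≤ L)
    {m : Fin d → ℝ} {η M : ℝ → Fin d → ℝ} (h : IsAdmissible m η M) :
    IntegrableOn (fun s => exp (-s) * relEnt (η s) (Kker A (M s))) (Ioi 0) := by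
  have hi : IntegrableOn (fun s : ℝ => L * exp (-s)) (Ioi 0) :=
    (integrableOn_exp_neg_Ioi 0).const_mul L
  refine Integrable.mono' hi ?_ ?_
  · have hM : ∀ x, AEMeasurable (fun s => M s x) (volume.restrict (Ioi 0)) := fun x =>
      (((continuous_apply x).comp_continuousOn h.2.2.1.1).mono
        Ioi_subset_Ici_self).aemeasurable measurableSet_Ioi
    apply AEMeasurable.aestronglyMeasurable
    refine AEMeasurable.mul (by fun_prop) ?_
    unfold relEnt Kker
    refine Finset.aemeasurable_fun_sum _ fun x _ => ?_
    refine (h.1 x).aemeasurable.mul (Real.measurable_log.comp_aemeasurable ?_)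
    refine (h.1 x).aemeasurable.div (Finset.aemeasurable_fun_sum _ fun y _ => ?_)
    exact (hM y).mul_const _
  · filter_upwards [ae_restrict_mem measurableSet_Ioi] with s hs
    have hs : 0 ≤ s := le_of_lt hs
    rw [norm_mul, Real.norm_eq_abs, Real.norm_eq_abs, abs_of_pos (exp_pos _), mul_comm]
    exact mul_le_mul_of_nonneg_right (hL _ (h.2.1 s hs) _ (h.2.2.2 s hs)) (exp_pos _).le

lemma aux_bdd {d : ℕ} {A : Fin d → Fin d → ℝ} {L : ℝ}
    (hL : ∀ ν ∈ stdSimplex ℝ (Fin d), ∀ μ ∈ stdSimplex ℝ (Fin d), |relEnt ν (Kker A μ)| ≤ L)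
    (m : Fin d → ℝ) :
    BddBelow { c | ∃ η M : ℝ → Fin d → ℝ, IsAdmissible m η M ∧ c = cost A η M } := by
  refine ⟨-L, ?_⟩
  rintro c ⟨η, M, h, rfl⟩
  have h1 : ∫ s in Ioi (0:ℝ), (-L) * exp (-s) = -L := by
    rw [integral_const_mul, integral_exp_neg_Ioi_zero, mul_one]
  rw [← h1]
  refine setIntegral_mono_on ((integrableOn_exp_neg_Ioi 0).const_mul _) (aux_integrable hL h)
    measurableSet_Ioi fun s hs => ?_
  have hs : 0 ≤ s := le_of_lt hs
  rw [mul_comm]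
  exact mul_le_mul_of_nonneg_left (abs_le.1 (hL _ (h.2.1 s hs) _ (h.2.2.2 s hs))).1 (exp_pos _).le

lemma aux_nonempty {d : ℕ} (A : Fin d → Fin d → ℝ) {m : Fin d → ℝ}
    (hm : m ∈ stdSimplex ℝ (Fin d)) :
    { c | ∃ η M : ℝ → Fin d → ℝ, IsAdmissible m η M ∧ c = cost A η M }.Nonempty := by
  refine ⟨_, fun _ => m, fun _ => m, ⟨fun x => measurable_const, fun _ _ => hm,
    ⟨continuousOn_const, fun t ht x => ?_⟩, fun _ _ => hm⟩, rfl⟩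
  simp

/-- coupling matrix -/
lemma aux_coupling {d : ℕ} {m m' : Fin d → ℝ} (hm : m ∈ stdSimplex ℝ (Fin d))
    (hm' : m' ∈ stdSimplex ℝ (Fin d)) :
    ∃ (B : Fin d → Fin d → ℝ) (c : Fin d → ℝ), (∀ x y, 0 ≤ B x y) ∧ (∀ x, ∑ y, B x y = 1) ∧
      Kker B m' = m ∧ (∀ x, 0 ≤ c x) ∧
      (∀ ν ∈ stdSimplex ℝ (Fin d), dist (Kker B ν) ν ≤ ∑ x, c x * ν x) ∧
      ∑ x, c x * m' x ≤ ∑ x, |m x - m' x| := by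
  -- r x * m' x = min (m x) (m' x)
  have hr : ∀ x, ∃ r : ℝ, 0 ≤ r ∧ r ≤ 1 ∧ r * m' x = min (m x) (m' x) := by
    intro x
    rcases (hm'.1 x).eq_or_lt with h0 | h0
    · refine ⟨1, by simp, le_rfl, ?_⟩
      rw [← h0, min_eq_right (hm.1 x)]; simp
    · refine ⟨min (m x) (m' x) / m' x, div_nonneg (le_min (hm.1 x) h0.le) h0.le, ?_, ?_⟩
      · rw [div_le_one h0]; exact min_le_right _ _
      · field_simp
  choose r hr0 hr1 hr using hr
  set D : ℝ := ∑ x, (m x - min (m x) (m' x)) with hD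
  have hD' : D = ∑ x, (1 - r x) * m' x := by
    simp_rw [sub_mul, hr, one_mul]
    rw [hD, Finset.sum_sub_distrib, Finset.sum_sub_distrib, hm.2, hm'.2]
  have hw : ∀ x, 0 ≤ m x - min (m x) (m' x) := fun x => sub_nonneg.2 (min_le_left _ _)
  obtain ⟨q, hq, hqD⟩ : ∃ q ∈ stdSimplex ℝ (Fin d),
      ∀ x, D * q x = m x - min (m x) (m' x) := by
    have hD0 : 0 ≤ D := Finset.sum_nonneg fun x _ => hw x
    rcases hD0.eq_or_lt with h0 | h0
    · refine ⟨m, hm, fun x => ?_⟩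
      have := (Finset.sum_eq_zero_iff_of_nonneg fun x _ => hw x).1 h0.symm x (Finset.mem_univ x)
      rw [this, ← h0, zero_mul]
    · refine ⟨fun x => (m x - min (m x) (m' x)) / D, ⟨fun x => div_nonneg (hw x) h0.le, ?_⟩, ?_⟩
      · rw [← Finset.sum_div, ← hD, div_self h0.ne']
      · intro x
        exact mul_div_cancel₀ _ h0.ne'
  have hK : ∀ ν y, Kker (fun x y => (if x = y then r x else 0) + (1 - r x) * q y) ν y
      = r y * ν y + (∑ x, (1 - r x) * ν x) * q y := by
    intro ν y
    simp only [Kker, mul_add, Finset.sum_add_distrib, mul_ite, mul_zero]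
    rw [Finset.sum_ite_eq' Finset.univ y]
    simp only [Finset.mem_univ, if_true, Finset.sum_mul]
    rw [mul_comm]
    congr 1
    exact Finset.sum_congr rfl fun x _ => by ring
  refine ⟨fun x y => (if x = y then r x else 0) + (1 - r x) * q y, fun x => 1 - r x,
    ?_, ?_, ?_, fun x => sub_nonneg.2 (hr1 x), ?_, ?_⟩
  · intro x y
    have : 0 ≤ (1 - r x) * q y := mul_nonneg (sub_nonneg.2 (hr1 x)) (hq.1 y)
    have h2 := hr0 x
    show 0 ≤ (if x = y then r x else 0) + (1 - r x) * q y
    split_ifs <;> linarith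
  · intro x
    rw [Finset.sum_add_distrib, ← Finset.mul_sum, hq.2]
    simp
  · funext y
    rw [hK, ← hD', hqD, hr]; ring
  · intro ν hν
    have hθ : ∀ y, (1 - r y) * ν y ≤ ∑ x, (1 - r x) * ν x := fun y =>
      Finset.single_le_sum (f := fun x => (1 - r x) * ν x)
        (fun x _ => mul_nonneg (sub_nonneg.2 (hr1 x)) (hν.1 x)) (Finset.mem_univ y)
    have hθ0 : 0 ≤ ∑ x, (1 - r x) * ν x :=
      Finset.sum_nonneg fun x _ => mul_nonneg (sub_nonneg.2 (hr1 x)) (hν.1 x)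
    rw [dist_pi_le_iff hθ0]
    intro y
    rw [hK, Real.dist_eq, abs_le]
    have h1 := hθ y
    have h2 := mul_le_mul_of_nonneg_left (aux_le_one hq y) hθ0
    have h3 := mul_nonneg hθ0 (hq.1 y)
    have h4 := mul_nonneg (sub_nonneg.2 (hr1 y)) (hν.1 y)
    constructor <;> nlinarith
  · rw [← hD', hD]
    refine Finset.sum_le_sum fun x _ => ?_
    rcases le_total (m x) (m' x) with h | h
    · rw [min_eq_left h]; simp
    · rw [min_eq_right h]; exact le_abs_self _

lemma aux_cost {d : ℕ} {A : Fin d → Fin d → ℝ} {L ε C T : ℝ} (hL0 : 0 ≤ L) (hε : 0 ≤ ε)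
    (hC0 : 0 ≤ C) (hT : 0 ≤ T)
    (hL : ∀ ν ∈ stdSimplex ℝ (Fin d), ∀ μ ∈ stdSimplex ℝ (Fin d), |relEnt ν (Kker A μ)| ≤ L)
    (hC : ∀ ν ∈ stdSimplex ℝ (Fin d), ∀ μ ∈ stdSimplex ℝ (Fin d),
        ∀ ν' ∈ stdSimplex ℝ (Fin d), ∀ μ' ∈ stdSimplex ℝ (Fin d),
        relEnt ν (Kker A μ) - relEnt ν' (Kker A μ') ≤ ε + C * (dist ν ν' + dist μ μ'))
    {m m' : Fin d → ℝ} (hm : m ∈ stdSimplex ℝ (Fin d)) (hm' : m' ∈ stdSimplex ℝ (Fin d))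
    {η M : ℝ → Fin d → ℝ} (h : IsAdmissible m' η M) :
    rateI A m ≤ cost A η M + ε + C * (2 * exp T * ∑ x, |m x - m' x|) + 2 * L * exp (-T) := by
  obtain ⟨B, c, hB, hBr, hBm, hc, hBd, hcs⟩ := aux_coupling hm hm'
  have hp := aux_push h hB hBr
  rw [hBm] at hp
  have h0 : rateI A m ≤ cost A (fun s => Kker B (η s)) (fun s => Kker B (M s)) :=
    csInf_le (aux_bdd hL m) ⟨_, _, hp, rfl⟩
  set θ : ℝ → ℝ := fun s => C * ∑ x, c x * (η s x + M s x) with hθ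
  have hθi : IntervalIntegrable θ volume 0 T := by
    have := IntervalIntegrable.sum (μ := volume) (a := 0) (b := T) Finset.univ
      (f := fun x s => c x * (η s x + M s x))
      (fun x _ => ((aux_intη h hT x).add (aux_intM h hT x)).const_mul (c x))
    have := this.const_mul C
    convert this using 2 with s
    simp [hθ]
  have hθint : ∫ s in (0:ℝ)..T, θ s ≤ C * (2 * exp T * ∑ x, |m x - m' x|) := by
    simp only [hθ]
    rw [intervalIntegral.integral_const_mul, intervalIntegral.integral_finsetSum
      (fun x _ => ((aux_intη h hT x).add (aux_intM h hT x)).const_mul (c x))]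
    refine mul_le_mul_of_nonneg_left ?_ hC0
    calc _ ≤ ∑ x, 2 * exp T * (c x * m' x) := by
          refine Finset.sum_le_sum fun x _ => ?_
          rw [intervalIntegral.integral_const_mul,
            intervalIntegral.integral_add (aux_intη h hT x) (aux_intM h hT x)]
          obtain ⟨h1, h2⟩ := aux_growth h hT x
          have := mul_le_mul_of_nonneg_left (add_le_add h1 h2) (hc x)
          linarith
      _ ≤ _ := by
          rw [← Finset.mul_sum]
          exact mul_le_mul_of_nonneg_left hcs (by positivity)
  have hθI : IntegrableOn θ (Ioc 0 T) := (intervalIntegrable_iff_integrableOn_Ioc_of_le hT).1 hθi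
  have hT' : IntegrableOn (fun s : ℝ => 2 * L * exp (-s)) (Ioi T) :=
    (integrableOn_exp_neg_Ioi T).const_mul _
  have i1 : IntegrableOn (fun s : ℝ => ε * exp (-s)) (Ioi 0) :=
    (integrableOn_exp_neg_Ioi 0).const_mul _
  have i2 : Integrable ((Ioc 0 T).indicator θ) (volume.restrict (Ioi 0)) :=
    (hθI.integrable_indicator measurableSet_Ioc).integrableOn
  have i3 : Integrable ((Ioi T).indicator fun s : ℝ => 2 * L * exp (-s))
      (volume.restrict (Ioi 0)) :=
    (hT'.integrable_indicator measurableSet_Ioi).integrableOn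
  have i0 := aux_integrable hL h
  have j1 : Integrable (fun s => exp (-s) * relEnt (η s) (Kker A (M s)) + ε * exp (-s))
      (volume.restrict (Ioi 0)) := i0.add i1
  have j2 : Integrable (fun s => exp (-s) * relEnt (η s) (Kker A (M s)) + ε * exp (-s) +
      (Ioc 0 T).indicator θ s) (volume.restrict (Ioi 0)) := j1.add i2
  have key : cost A (fun s => Kker B (η s)) (fun s => Kker B (M s)) ≤
      ∫ s in Ioi (0:ℝ), (((exp (-s) * relEnt (η s) (Kker A (M s)) + ε * exp (-s)) +
        (Ioc 0 T).indicator θ s) + (Ioi T).indicator (fun s : ℝ => 2 * L * exp (-s)) s) := by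
    refine setIntegral_mono_on (aux_integrable hL hp) (((i0.add i1).add i2).add i3)
      measurableSet_Ioi fun s hs => ?_
    have hs' : 0 < s := hs
    have hs : 0 ≤ s := hs'.le
    have a1 := h.2.1 s hs
    have a2 := h.2.2.2 s hs
    have b1 := hp.2.1 s hs
    have b2 := hp.2.2.2 s hs
    simp only at b1 b2
    have he := exp_pos (-s)
    by_cases hsT : s ≤ T
    · have m1 : s ∈ Ioc 0 T := ⟨hs', hsT⟩
      have m2 : s ∉ Ioi T := by simpa using hsT
      rw [indicator_of_mem m1, indicator_of_notMem m2]
      have h1 := hC _ b1 _ b2 _ a1 _ a2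
      have h2 : C * (dist (Kker B (η s)) (η s) + dist (Kker B (M s)) (M s)) ≤ θ s := by
        refine mul_le_mul_of_nonneg_left ?_ hC0
        simp_rw [mul_add, Finset.sum_add_distrib]
        exact add_le_add (hBd _ a1) (hBd _ a2)
      have h3 : 0 ≤ θ s := le_trans (by positivity) h2
      have h4 : exp (-s) ≤ 1 := exp_le_one_iff.2 (by linarith)
      have h5 := mul_le_mul_of_nonneg_left (h1.trans (add_le_add_right h2 ε)) he.le
      have h6 := mul_le_mul_of_nonneg_right h4 h3
      nlinarith
    · have m1 : s ∉ Ioc 0 T := fun h => hsT h.2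
      have m2 : s ∈ Ioi T := by simpa using hsT
      rw [indicator_of_notMem m1, indicator_of_mem m2]
      have h1 := (abs_le.1 (hL _ b1 _ b2)).2
      have h2 := (abs_le.1 (hL _ a1 _ a2)).1
      have h3 := mul_nonneg hε he.le
      nlinarith
  rw [integral_add j2 i3, integral_add j1 i2, integral_add i0 i1,
    integral_const_mul, integral_exp_neg_Ioi_zero, setIntegral_indicator measurableSet_Ioc,
    setIntegral_indicator measurableSet_Ioi] at key
  have e1 : Ioi (0:ℝ) ∩ Ioc 0 T = Ioc 0 T := inter_eq_right.2 fun s hs => hs.1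
  have e2 : Ioi (0:ℝ) ∩ Ioi T = Ioi T := inter_eq_right.2 fun s hs => lt_of_le_of_lt hT hs
  rw [e1, e2, ← intervalIntegral.integral_of_le hT, integral_const_mul (2 * L),
    integral_exp_neg_Ioi] at key
  have : cost A η M = ∫ s in Ioi (0:ℝ), exp (-s) * relEnt (η s) (Kker A (M s)) := rfl
  linarith

lemma aux_main {d : ℕ} {A : Fin d → Fin d → ℝ} {δ₀ : ℝ} (hδ₀ : 0 < δ₀)
    (hA : ∀ x y, δ₀ ≤ A x y) :
    ∀ ε > 0, ∃ δ > 0, ∀ m ∈ stdSimplex ℝ (Fin d), ∀ m' ∈ stdSimplex ℝ (Fin d),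
      dist m m' < δ → rateI A m ≤ rateI A m' + ε := by
  intro ε hε
  obtain ⟨L, hL0, hL, hmod⟩ := aux_modulus hδ₀ hA
  obtain ⟨C, hC0, hC⟩ := hmod (ε / 4) (by positivity)
  obtain ⟨T, hT0, hT⟩ : ∃ T : ℝ, 0 ≤ T ∧ 2 * L * exp (-T) ≤ ε / 4 := by
    have h1 : Filter.Tendsto (fun T : ℝ => 2 * L * exp (-T)) Filter.atTop (nhds (2 * L * 0)) :=
      (Real.tendsto_exp_neg_atTop_nhds_zero).const_mul _
    rw [mul_zero] at h1
    obtain ⟨T, h2, h3⟩ := ((h1.eventually_le_const (by positivity : 0 < ε / 4)).and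
      (Filter.eventually_ge_atTop 0)).exists
    exact ⟨T, h3, h2⟩
  have hP : 0 < C * (2 * exp T * d) + 1 := by positivity
  refine ⟨ε / 4 / (C * (2 * exp T * d) + 1), by positivity, fun m hm m' hm' hd => ?_⟩
  rw [← sub_le_iff_le_add]
  refine le_csInf (aux_nonempty A hm') ?_
  rintro _ ⟨η, M, h, rfl⟩
  have h1 := aux_cost hL0 (by positivity) hC0 hT0 hL hC hm hm' h
  have h2 : ∑ x, |m x - m' x| ≤ d * dist m m' := by
    calc _ ≤ ∑ _x : Fin d, dist m m' := Finset.sum_le_sum fun x _ => by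
          rw [← Real.dist_eq]; exact dist_le_pi_dist m m' x
      _ = _ := by simp
  rw [lt_div_iff₀ hP] at hd
  have h3 : C * (2 * exp T * ∑ x, |m x - m' x|) ≤ C * (2 * exp T * (d * dist m m')) := by
    gcongr
  have h4 : 0 ≤ dist m m' := dist_nonneg
  nlinarith

/-- The rate function `I` has compact sublevel sets in the simplex; in particular it is lower
semicontinuous on the simplex. -/
theorem rate_function_compact_sublevel_sets {d : ℕ} (A : Fin d → Fin d → ℝ) (δ₀ : ℝ)
    (hδ₀ : 0 < δ₀) (hA : ∀ x y, δ₀ ≤ A x y) (hrow : ∀ x, ∑ y, A x y = 1) :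
    (∀ k : ℝ, 0 < k →
      IsCompact {m : Fin d → ℝ | m ∈ stdSimplex ℝ (Fin d) ∧ rateI A m ≤ k}) ∧
    LowerSemicontinuousOn (rateI A) (stdSimplex ℝ (Fin d)) := by
  have hc : ContinuousOn (rateI A) (stdSimplex ℝ (Fin d)) := by
    rw [Metric.continuousOn_iff]
    intro m hm ε hε
    obtain ⟨δ, hδ, h⟩ := aux_main hδ₀ hA (ε / 2) (by positivity)
    refine ⟨δ, hδ, fun m' hm' hd => ?_⟩
    have h1 := h m' hm' m hm hd
    have h2 := h m hm m' hm' (by rwa [dist_comm])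
    rw [Real.dist_eq, abs_lt]
    constructor <;> linarith
  refine ⟨fun k _ => ?_, hc.lowerSemicontinuousOn⟩
  have hcl : IsClosed (stdSimplex ℝ (Fin d)) := isClosed_stdSimplex ℝ _
  exact (isCompact_stdSimplex ℝ (Fin d)).of_isClosed_subset
    (hc.preimage_isClosed_of_isClosed hcl isClosed_Iic) fun m hm => hm.1
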